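/- For every k ≥ 1, with N = M^k, one has t_k ≤ N^{−3/2}·|C_k|^{3/2}·E(C_k)^{1/2}. -/

import Mathlib

open scoped BigOperators

/-- The Cantor iterates `C_k = {Σ_{j<k} a_j M^j : a_j ∈ A} ⊆ {0,…,M^k-1}`. -/
def Ck (M : ℕ) (A : Finset ℕ) (k : ℕ) : Finset ℕ :=
  (Fintype.piFinset fun _ : Fin k => A).image fun a => ∑ j : Fin k, a j * M ^ (j : ℕ)

/-- The discrete Fourier transform of the indicator function of `S ⊆ Z_N`,
`F_N(1_S)(m) = N^{-1/2} Σ_{l<N} 1_S(l) exp(-2πi m l / N)`; it is `N`-periodic in `m`,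
so a residue `m ∈ Z_N` may be fed in via any integer representative. -/
noncomputable def dftInd (N : ℕ) (S : Finset ℕ) (m : ℕ) : ℂ :=
  ((1 : ℝ) / Real.sqrt N : ℝ) * ∑ l ∈ Finset.range N,
    (if l ∈ S then (1 : ℂ) else 0) * Complex.exp (-(2 * (Real.pi : ℂ) * Complex.I * m * l) / N)

/-- `t_k = (1/N) Σ_{j,ℓ ∈ Z_N} 1_{C_k}(j) 1_{C_k}(ℓ) |F_N(1_{C_k})(ℓ-j)|²`, `N = M^k`,
where `ℓ - j` is taken in `Z_N` (represented by `ℓ + N - j ≡ ℓ - j (mod N)`). -/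
noncomputable def tk (M : ℕ) (A : Finset ℕ) (k : ℕ) : ℝ :=
  ((1 : ℝ) / ((M ^ k : ℕ) : ℝ)) * ∑ j ∈ Finset.range (M ^ k), ∑ l ∈ Finset.range (M ^ k),
    (if j ∈ Ck M A k then (1 : ℝ) else 0) * (if l ∈ Ck M A k then (1 : ℝ) else 0) *
      ‖dftInd (M ^ k) (Ck M A k) (l + M ^ k - j)‖ ^ 2

/-- The additive energy of `X ⊆ Z_N`. -/
def addE (N : ℕ) (X : Finset ℕ) : ℕ :=
  (((X ×ˢ X) ×ˢ (X ×ˢ X)).filter fun p => (p.1.1 + p.1.2) % N = (p.2.1 + p.2.2) % N).card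

theorem Ck_subset_range {M : ℕ} {A : Finset ℕ} (hA : A ⊆ Finset.range M) (k : ℕ) :
    Ck M A k ⊆ Finset.range (M ^ k) := by
  intro x hx
  obtain ⟨a, ha, rfl⟩ := Finset.mem_image.1 hx
  have h : ∀ i, a i < M := fun i => Finset.mem_range.1 (hA (Fintype.mem_piFinset.1 ha i))
  have := (finFunctionFinEquiv (fun i => (⟨a i, h i⟩ : Fin M))).isLt
  rw [finFunctionFinEquiv_apply] at this
  exact Finset.mem_range.2 this

/-- The unnormalised power spectrum of the indicator function of `S`, as a function on `ZMod N`. -/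
noncomputable def powerSpectrum (N : ℕ) [NeZero N] (S : Finset ℕ) (m : ZMod N) : ℝ :=
  ‖∑ l ∈ S, ZMod.stdAddChar (N := N) (-(m * l))‖ ^ 2

theorem powerSpectrum_nonneg (N : ℕ) [NeZero N] (S : Finset ℕ) (m : ZMod N) :
    0 ≤ powerSpectrum N S m := sq_nonneg _

theorem powerSpectrum_le (N : ℕ) [NeZero N] (S : Finset ℕ) (m : ZMod N) :
    powerSpectrum N S m ≤ (S.card : ℝ) ^ 2 := by
  unfold powerSpectrum
  gcongr
  refine (norm_sum_le _ _).trans ?_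
  simp [AddChar.norm_apply]

theorem norm_dftInd_sq {N : ℕ} [NeZero N] {S : Finset ℕ} (hS : S ⊆ Finset.range N) (m : ℕ) :
    ‖dftInd N S m‖ ^ 2 = powerSpectrum N S m / N := by
  have h : ∑ l ∈ Finset.range N, (if l ∈ S then (1 : ℂ) else 0) *
      Complex.exp (-(2 * (Real.pi : ℂ) * Complex.I * m * l) / N) =
      ∑ l ∈ S, ZMod.stdAddChar (N := N) (-((m : ZMod N) * l)) := by
    simp only [ite_mul, one_mul, zero_mul]
    rw [← Finset.sum_filter, Finset.filter_mem_eq_inter, Finset.inter_eq_right.2 hS]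
    refine Finset.sum_congr rfl fun l _ => ?_
    have := ZMod.stdAddChar_coe (N := N) (-((m : ℤ) * l))
    push_cast at this
    rw [this]
    congr 1
    ring
  rw [dftInd, h, norm_mul, mul_pow, powerSpectrum, Complex.norm_real, Real.norm_eq_abs, sq_abs,
    div_pow, one_pow, Real.sq_sqrt (Nat.cast_nonneg N)]
  ring

/-- Parseval's identity for the indicator function of `S`. -/
theorem sum_powerSpectrum {N : ℕ} [NeZero N] {S : Finset ℕ} (hS : S ⊆ Finset.range N) :
    ∑ m : ZMod N, powerSpectrum N S m = N * S.card := by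
  have key : ∑ m : ZMod N, (powerSpectrum N S m : ℂ) = N * S.card := by
    have h : ∀ m : ZMod N, (powerSpectrum N S m : ℂ) =
        ∑ a ∈ S, ∑ b ∈ S, ZMod.stdAddChar (N := N) (m * ((b : ZMod N) - a)) := by
      intro m
      rw [powerSpectrum, Complex.ofReal_pow, ← Complex.mul_conj', map_sum, Finset.sum_mul_sum]
      refine Finset.sum_congr rfl fun a _ => Finset.sum_congr rfl fun b _ => ?_
      rw [← AddChar.map_neg_eq_conj, ← AddChar.map_add_eq_mul]
      congr 1
      ring
    simp_rw [h]
    rw [Finset.sum_comm]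
    have h' : ∀ a ∈ S, ∑ m : ZMod N, ∑ b ∈ S, ZMod.stdAddChar (N := N) (m * ((b : ZMod N) - a)) =
        (N : ℂ) := by
      intro a ha
      rw [Finset.sum_comm, Finset.sum_eq_single_of_mem a ha]
      · simp [ZMod.card]
      · intro b hb hba
        rw [AddChar.sum_mulShift _ (ZMod.isPrimitive_stdAddChar N), if_neg, Nat.cast_zero]
        rw [sub_eq_zero, ZMod.natCast_eq_natCast_iff',
          Nat.mod_eq_of_lt (Finset.mem_range.1 (hS hb)),
          Nat.mod_eq_of_lt (Finset.mem_range.1 (hS ha))]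
        exact hba
    rw [Finset.sum_congr rfl h', Finset.sum_const, nsmul_eq_mul, mul_comm]
  exact_mod_cast key

theorem sum_card_sub_fiber_sq (N : ℕ) [NeZero N] (S : Finset ℕ) :
    ∑ m : ZMod N, ((S ×ˢ S).filter fun p => ((p.2 : ZMod N) - p.1) = m).card ^ 2 = addE N S := by
  rw [addE]
  rw [Finset.card_eq_sum_card_fiberwise
    (f := fun p => ((p.1.1 : ZMod N) - p.2.1)) (t := Finset.univ) (by simp [Set.MapsTo])]
  refine Finset.sum_congr rfl fun m _ => ?_
  rw [sq, ← Finset.card_product]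
  refine Finset.card_nbij' (fun p => ((p.1.2, p.2.1), (p.1.1, p.2.2)))
    (fun p => ((p.2.1, p.1.1), (p.1.2, p.2.2))) ?_ ?_ (fun _ _ => rfl) (fun _ _ => rfl)
  · rintro ⟨⟨a, b⟩, c, d⟩ h
    simp only [Finset.coe_product, Finset.coe_filter, Finset.mem_product, Set.mem_prod,
      Set.mem_ofPred_eq, Finset.mem_filter, ← ZMod.natCast_eq_natCast_iff', Nat.cast_add] at h ⊢
    obtain ⟨⟨⟨ha, hb⟩, h1⟩, ⟨hc, hd⟩, h2⟩ := h
    exact ⟨⟨⟨⟨hb, hc⟩, ha, hd⟩, by linear_combination h1 - h2⟩, h1⟩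
  · rintro ⟨⟨a, b⟩, c, d⟩ h
    simp only [Finset.coe_product, Finset.coe_filter, Finset.mem_product, Set.mem_prod,
      Set.mem_ofPred_eq, Finset.mem_filter, ← ZMod.natCast_eq_natCast_iff', Nat.cast_add] at h ⊢
    obtain ⟨⟨⟨⟨ha, hb⟩, hc, hd⟩, h1⟩, h2⟩ := h
    exact ⟨⟨⟨hc, ha⟩, h2⟩, ⟨hb, hd⟩, by linear_combination h2 - h1⟩

theorem sq_sum_powerSpectrum_sub_le {N : ℕ} [NeZero N] {S : Finset ℕ}
    (hS : S ⊆ Finset.range N) :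
    (∑ p ∈ S ×ˢ S, powerSpectrum N S ((p.2 : ZMod N) - p.1)) ^ 2 ≤
      addE N S * (N * (S.card : ℝ) ^ 3) := by
  rw [← Finset.sum_fiberwise' _ (fun p : ℕ × ℕ => (p.2 : ZMod N) - p.1)]
  simp_rw [Finset.sum_const, nsmul_eq_mul]
  refine (Finset.sum_mul_sq_le_sq_mul_sq _ _ _).trans ?_
  have h1 : ∑ m : ZMod N,
      ((((S ×ˢ S).filter fun p => ((p.2 : ZMod N) - p.1) = m).card : ℕ) : ℝ) ^ 2 = addE N S := by
    exact_mod_cast sum_card_sub_fiber_sq N S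
  rw [h1]
  gcongr
  calc ∑ m : ZMod N, powerSpectrum N S m ^ 2
      ≤ ∑ m : ZMod N, (S.card : ℝ) ^ 2 * powerSpectrum N S m := by
        gcongr with m
        rw [sq]
        exact mul_le_mul_of_nonneg_right (powerSpectrum_le N S m) (powerSpectrum_nonneg N S m)
    _ = N * (S.card : ℝ) ^ 3 := by
        rw [← Finset.mul_sum, sum_powerSpectrum hS]
        ring

theorem tk_eq_sum_powerSpectrum {M : ℕ} {A : Finset ℕ} (hA : A ⊆ Finset.range M) (k : ℕ)
    [NeZero (M ^ k)] :
    tk M A k = (∑ p ∈ Ck M A k ×ˢ Ck M A k,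
      powerSpectrum (M ^ k) (Ck M A k) ((p.2 : ZMod (M ^ k)) - p.1)) / ((M ^ k : ℕ) : ℝ) ^ 2 := by
  have hS := Ck_subset_range hA k
  rw [tk]
  generalize Ck M A k = S at hS ⊢
  generalize M ^ k = N at *
  have h : ∑ j ∈ Finset.range N, ∑ l ∈ Finset.range N,
      (if j ∈ S then (1 : ℝ) else 0) * (if l ∈ S then (1 : ℝ) else 0) *
        ‖dftInd N S (l + N - j)‖ ^ 2 =
      ∑ j ∈ S, ∑ l ∈ S, powerSpectrum N S ((l : ZMod N) - j) / N := by
    rw [← Finset.sum_subset hS fun j _ hj => by simp [hj]]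
    refine Finset.sum_congr rfl fun j hj => ?_
    rw [← Finset.sum_subset hS fun l _ hl => by simp [hl]]
    refine Finset.sum_congr rfl fun l hl => ?_
    have hjN : j ≤ l + N := (Finset.mem_range.1 (hS hj)).le.trans (Nat.le_add_left _ _)
    rw [if_pos hj, if_pos hl, norm_dftInd_sq hS, Nat.cast_sub hjN]
    simp
  rw [h, ← Finset.sum_product', ← Finset.sum_div]
  field_simp

/-- For every `k ≥ 1`, with `N = M^k`,
`t_k ≤ N^{-3/2} · |C_k|^{3/2} · E(C_k)^{1/2}`. -/
theorem stmt9 (M : ℕ) (hM : 2 ≤ M) (A : Finset ℕ) (hAne : A.Nonempty)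
    (hA : A ⊆ Finset.range M) (k : ℕ) (hk : 1 ≤ k) :
    tk M A k ≤ ((M ^ k : ℕ) : ℝ) ^ (-(3 / 2) : ℝ) * ((Ck M A k).card : ℝ) ^ ((3 / 2) : ℝ) *
      ((addE (M ^ k) (Ck M A k) : ℕ) : ℝ) ^ ((1 / 2) : ℝ) := by
  have : NeZero (M ^ k) := ⟨by positivity⟩
  have hN : (0 : ℝ) < ((M ^ k : ℕ) : ℝ) := Nat.cast_pos.2 (NeZero.pos _)
  have h := sq_sum_powerSpectrum_sub_le (Ck_subset_range hA k)
  have rpow_sq : ∀ (x s : ℝ), 0 ≤ x → (x ^ s) ^ 2 = x ^ (s * 2) := fun x s hx => by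
    rw [Real.rpow_mul hx, Real.rpow_two]
  refine le_of_sq_le_sq ?_ (by positivity)
  rw [tk_eq_sum_powerSpectrum hA, div_pow, mul_pow, mul_pow, rpow_sq _ _ hN.le,
    rpow_sq _ _ (Nat.cast_nonneg _), rpow_sq _ _ (Nat.cast_nonneg _)]
  have e1 : ((M ^ k : ℕ) : ℝ) ^ (-(3 / 2) * 2 : ℝ) = (((M ^ k : ℕ) : ℝ) ^ 3)⁻¹ := by
    rw [← Real.rpow_natCast, ← Real.rpow_neg hN.le]
    norm_num
  have e2 : ((Ck M A k).card : ℝ) ^ (3 / 2 * 2 : ℝ) = ((Ck M A k).card : ℝ) ^ 3 := by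
    rw [← Real.rpow_natCast]
    norm_num
  rw [e1, e2, one_div, inv_mul_cancel₀ two_ne_zero, Real.rpow_one, div_le_iff₀ (by positivity)]
  refine h.trans_eq ?_
  field_simp
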